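/- Let ν, b, μ, k, ξ₀ be real with ν ≠ 0, b² = 16 μ ν and ν k² = μ, and set A = −18 μ³/ν. Define τ(ξ) = (k/2) tanh( k(ξ−ξ₀)/2 ) and u(ξ) = 120ν τ³ − 15b τ² + (60μ/19 − 30ν k² − 15b²/(76ν)) τ + (5/2) b k² − 13 b³/(608 ν²) + 7 μ b/(76 ν). Then u satisfies the KS travelling-wave ODE ν u''' + b u'' + μ u' + u²/2 + A = 0 for all real ξ. -/

import Mathlib

/-- The scaled hyperbolic tangent satisfies the Riccati equation `τ' = k² / 4 - τ²`. -/
theorem hasDerivAt_half_mul_tanh (k ξ₀ ξ : ℝ) :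
    HasDerivAt (fun x : ℝ => k / 2 * Real.tanh (k * (x - ξ₀) / 2))
      (k ^ 2 / 4 - (k / 2 * Real.tanh (k * (ξ - ξ₀) / 2)) ^ 2) ξ := by
  have hlin : HasDerivAt (fun x : ℝ => k * (x - ξ₀) / 2) (k / 2) ξ := by
    simpa using (((hasDerivAt_id ξ).sub_const ξ₀).const_mul k).div_const 2
  have hc : Real.cosh (k * (ξ - ξ₀) / 2) ≠ 0 := (Real.cosh_pos _).ne'
  have h := ((hlin.sinh.div hlin.cosh hc).const_mul (k / 2))
  simp only [Real.tanh_eq_sinh_div_cosh]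
  refine h.congr_deriv ?_
  field_simp
  ring

/-- Differentiating a polynomial in a solution of the Riccati equation `τ' = a - τ²`
gives again a polynomial in `τ`. -/
theorem deriv_polynomial_eval_of_riccati {τ : ℝ → ℝ} {a : ℝ}
    (hτ : ∀ x, HasDerivAt τ (a - τ x ^ 2) x) (P : Polynomial ℝ) :
    deriv (fun x => P.eval (τ x)) =
      fun x => (P.derivative * (Polynomial.C a - Polynomial.X ^ 2)).eval (τ x) := by
  funext x
  have h : HasDerivAt (fun y => P.eval (τ y)) _ x := (P.hasDerivAt (τ x)).comp x (hτ x)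
  simpa using h.deriv


/-- Trigonometric degeneracy of the elliptic KS solution, b²/(μν) = 16. The third-degree polynomial in
`τ(ξ) = (k/2) tanh(k(ξ-ξ₀)/2)` satisfies the Kuramoto–Sivashinsky
travelling-wave ODE `ν u''' + b u'' + μ u' + u²/2 + A = 0` for all real ξ. -/
theorem ks_trig_solution_5 (ν b μ A k ξ₀ : ℝ) (hν : ν ≠ 0)
    (hb : b ^ 2 = 16 * μ * ν) (hk : ν * k ^ 2 = μ)
    (hA : A = -18 * μ ^ 3 / ν)
    (τ : ℝ → ℝ) (hτ : ∀ ξ : ℝ, τ ξ = k / 2 * Real.tanh (k * (ξ - ξ₀) / 2))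
    (u : ℝ → ℝ)
    (hu : ∀ ξ : ℝ, u ξ = 120 * ν * (τ ξ) ^ 3 - 15 * b * (τ ξ) ^ 2
      + (60 * μ / 19 - 30 * ν * k ^ 2 - 15 * b ^ 2 / (76 * ν)) * τ ξ
      + 5 / 2 * b * k ^ 2 - 13 * b ^ 3 / (608 * ν ^ 2)
      + 7 * μ * b / (76 * ν)) :
    ∀ ξ : ℝ,
      ν * deriv (deriv (deriv u)) ξ + b * deriv (deriv u) ξ
      + μ * deriv u ξ + (u ξ) ^ 2 / 2 + A = 0 := by
  have hric : ∀ x, HasDerivAt τ (k ^ 2 / 4 - τ x ^ 2) x := by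
    rw [funext hτ]
    exact hasDerivAt_half_mul_tanh k ξ₀
  subst hk
  have hb' : b ^ 2 = 16 * ν ^ 2 * k ^ 2 := by rw [hb]; ring
  have hA' : A = -18 * ν ^ 2 * k ^ 6 := by rw [hA]; field_simp
  have hb₁ : 15 * b ^ 2 / (76 * ν) = 60 * (ν * k ^ 2) / 19 := by
    rw [hb']; field_simp; ring
  have hb₂ : 13 * b ^ 3 / (608 * ν ^ 2) = 13 / 38 * b * k ^ 2 := by
    rw [pow_succ b 2, hb']; field_simp; ring
  have hb₃ : 7 * (ν * k ^ 2) * b / (76 * ν) = 7 / 76 * b * k ^ 2 := by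
    field_simp
  have hP : u = fun x => (Polynomial.C (120 * ν) * Polynomial.X ^ 3
      - Polynomial.C (15 * b) * Polynomial.X ^ 2
      - Polynomial.C (30 * ν * k ^ 2) * Polynomial.X
      + Polynomial.C (9 / 4 * b * k ^ 2)).eval (τ x) := by
    funext x
    rw [hu, hb₁, hb₂, hb₃]
    simp only [Polynomial.eval_add, Polynomial.eval_sub, Polynomial.eval_mul,
      Polynomial.eval_pow, Polynomial.eval_C, Polynomial.eval_X]
    ring
  intro ξ
  rw [hP]
  simp only [deriv_polynomial_eval_of_riccati hric]
  simp only [Polynomial.derivative_add, Polynomial.derivative_sub, Polynomial.derivative_mul,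
    Polynomial.derivative_X_pow, Polynomial.derivative_C, Polynomial.derivative_X,
    Polynomial.eval_add, Polynomial.eval_sub, Polynomial.eval_mul, Polynomial.derivative_zero,
    Polynomial.derivative_one, Polynomial.eval_zero, Polynomial.eval_one,
    Polynomial.eval_pow, Polynomial.eval_C, Polynomial.eval_X, hA']
  push_cast
  generalize τ ξ = t
  linear_combination (45 / 2 * t ^ 4 - 15 / 4 * t ^ 2 * k ^ 2 + 21 / 32 * k ^ 4) * hb'
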